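/- Let R₁, R₂ : ℝ → S(E) be smooth maps with R₁(t) ≥ R₂(t) for all t ∈ ℝ. For i = 1, 2, let Sᵢ : (0, tᵢ) → S(E) be a solution of the Riccati equation Sᵢ' + Sᵢ² + Rᵢ = 0 which cannot be extended beyond tᵢ. Assume that U := S₂ − S₁ has a continuous extension to t = 0 with U(0) ≥ 0. If S₁(s) = S₂(s) for some s ∈ (0, t₁), then S₁(t) = S₂(t) and R₁(t) = R₂(t) for all t ∈ (0, s]. -/

import Mathlib

open scoped RealInnerProductSpace

section
variable {E : Type*} [NormedAddCommGroup E] [InnerProductSpace ℝ E]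

theorem HasDerivAt.inner_clm_apply_self {T : ℝ → E →L[ℝ] E} {T' : E →L[ℝ] E} {t : ℝ}
    (h : HasDerivAt T T' t) (v : E) :
    HasDerivAt (fun r => ⟪T r v, v⟫) ⟪T' v, v⟫ t := by
  simpa using (h.clm_apply (hasDerivAt_const t v)).inner ℝ (hasDerivAt_const t v)

theorem apply_eq_zero_of_inner_apply_self_eq_zero {Q : E →L[ℝ] E}
    (hsymm : ∀ x y, ⟪Q x, y⟫ = ⟪x, Q y⟫) (hnonneg : ∀ x, 0 ≤ ⟪Q x, x⟫) {v : E}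
    (hv : ⟪Q v, v⟫ = 0) : Q v = 0 := by
  have key : ∀ r : ℝ, 0 ≤ ⟪Q (Q v), Q v⟫ * (r * r) + (2 * ⟪Q v, Q v⟫) * r + 0 := by
    intro r
    have h := hnonneg (v + r • Q v)
    simp only [map_add, map_smul, inner_add_left, inner_add_right, inner_smul_left,
      inner_smul_right, hv, hsymm (Q v) v, conj_trivial] at h
    linarith
  have h := discrim_le_zero key
  have h0 : ⟪Q v, Q v⟫ = 0 := by
    unfold discrim at h
    nlinarith [sq_nonneg ⟪Q v, Q v⟫]
  exact inner_self_eq_zero.mp h0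

theorem riccati_sub_deriv_eq (A₁ A₂ B₁ B₂ : E →L[ℝ] E) :
    -(A₂ * A₂) - B₂ - (-(A₁ * A₁) - B₁) =
      (-(1 / 2 : ℝ) • (A₁ + A₂)) * (A₂ - A₁) + (A₂ - A₁) * (-(1 / 2 : ℝ) • (A₁ + A₂)) +
        (B₁ - B₂) := by
  simp only [smul_mul_assoc, mul_smul_comm, mul_add, add_mul, mul_sub, sub_mul]
  module

theorem abs_inner_apply_self_le_norm (T : E →L[ℝ] E) {v : E} (hv : ‖v‖ = 1) :
    |⟪T v, v⟫| ≤ ‖T‖ := by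
  have h1 := abs_real_inner_le_norm (T v) v
  have h2 := T.le_opNorm v
  rw [hv, mul_one] at h1 h2
  exact h1.trans h2

variable [FiniteDimensional ℝ E]

theorem IsSelfAdjoint.norm_le_of_abs_inner_le {T : E →L[ℝ] E} (hT : IsSelfAdjoint T) {C : ℝ}
    (hC : ∀ v : E, ‖v‖ = 1 → |⟪T v, v⟫| ≤ C) (hC₀ : 0 ≤ C) : ‖T‖ ≤ C := by
  rw [T.norm_eq_iSup_rayleighQuotient
    (ContinuousLinearMap.isSelfAdjoint_iff_isSymmetric.mp hT)]
  refine ciSup_le fun x => ?_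
  rcases eq_or_ne x 0 with rfl | hx
  · simpa using hC₀
  · have hx' : ‖x‖ ≠ 0 := norm_ne_zero_iff.mpr hx
    rw [← T.rayleigh_smul x (c := ‖x‖⁻¹) (inv_ne_zero hx')]
    have h1 : ‖‖x‖⁻¹ • x‖ = 1 := by simp [norm_smul, hx']
    have := hC _ h1
    simpa [ContinuousLinearMap.rayleighQuotient, ContinuousLinearMap.reApplyInnerSelf, h1] using this

/-- A lower bound for a self-adjoint supersolution of the Lyapunov equation `U' = X U + U X`,
where `X` is bounded above. -/
theorem lyapunov_lower_bound {a b C δ : ℝ} (hδ : 0 < δ) {U X D : ℝ → E →L[ℝ] E}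
    (hU : ∀ t ∈ Set.Icc a b, HasDerivAt U (X t * U t + U t * X t + D t) t)
    (hUsa : ∀ t ∈ Set.Icc a b, IsSelfAdjoint (U t))
    (hX : ∀ t ∈ Set.Icc a b, ∀ v : E, ‖v‖ = 1 → ⟪X t v, v⟫ ≤ C)
    (hXsa : ∀ t ∈ Set.Icc a b, IsSelfAdjoint (X t))
    (hD : ∀ t ∈ Set.Icc a b, ∀ v : E, 0 ≤ ⟪D t v, v⟫)
    (ha : ∀ v : E, ‖v‖ = 1 → -δ < ⟪U a v, v⟫) {t : ℝ} (ht : t ∈ Set.Icc a b) {v : E}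
    (hv : ‖v‖ = 1) : -(δ * Real.exp ((2 * C + 1) * (t - a))) < ⟪U t v, v⟫ := by
  by_contra! hcon
  set h : ℝ → ℝ := fun t => δ * Real.exp ((2 * C + 1) * (t - a)) with h_def
  have hpos : ∀ t, 0 < h t := fun t => by positivity
  have hder : ∀ t, HasDerivAt h ((2 * C + 1) * h t) t := by
    intro t
    have h1 : HasDerivAt (fun t : ℝ => (2 * C + 1) * (t - a)) ((2 * C + 1) * 1) t :=
      ((hasDerivAt_id t).sub_const a).const_mul _
    exact (h1.exp.const_mul δ).congr_deriv (by ring)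
  have hUc : ContinuousOn U (Set.Icc a b) := fun t ht => (hU t ht).continuousAt.continuousWithinAt
  let φ : ℝ × E → ℝ := fun p => ⟪U p.1 p.2, p.2⟫ + h p.1
  have hφ : ContinuousOn φ (Set.Icc a b ×ˢ Metric.sphere (0 : E) 1) := by
    have h1 : ContinuousOn (fun p : ℝ × E => U p.1) (Set.Icc a b ×ˢ Metric.sphere (0 : E) 1) :=
      hUc.comp continuousOn_fst fun p hp => hp.1
    exact ((h1.clm_apply continuousOn_snd).inner continuousOn_snd).add
      ((continuous_iff_continuousAt.mpr fun t => (hder t).continuousAt).comp_continuousOn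
        continuousOn_fst)
  have hK : IsCompact (Set.Icc a b ×ˢ Metric.sphere (0 : E) 1) :=
    isCompact_Icc.prod (isCompact_sphere 0 1)
  have hZ : IsCompact ((Set.Icc a b ×ˢ Metric.sphere (0 : E) 1) ∩ φ ⁻¹' Set.Iic 0) :=
    hK.of_isClosed_subset (hφ.preimage_isClosed_of_isClosed hK.isClosed isClosed_Iic)
      Set.inter_subset_left
  obtain ⟨⟨τ, w⟩, ⟨⟨hτ, hw⟩, hτw⟩, hmin⟩ := hZ.exists_isMinOn
    ⟨(t, v), ⟨ht, by simpa using hv⟩, by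
      change ⟪U t v, v⟫ + h t ≤ 0
      linarith⟩ continuousOn_fst
  replace hτ : τ ∈ Set.Icc a b := hτ
  replace hw : ‖w‖ = 1 := by simpa using hw
  replace hτw : ⟪U τ w, w⟫ + h τ ≤ 0 := hτw
  have hbefore : ∀ r ∈ Set.Ico a τ, ∀ x : E, ‖x‖ = 1 → 0 < ⟪U r x, x⟫ + h r := by
    intro r hr x hx
    by_contra! hneg
    have : τ ≤ r := hmin (a := (r, x))
      ⟨⟨⟨hr.1, hr.2.le.trans hτ.2⟩, by simpa using hx⟩, hneg⟩
    exact absurd hr.2 (not_lt.mpr this)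
  have haτ : a < τ := by
    refine lt_of_le_of_ne hτ.1 fun h0 => ?_
    subst h0
    have := ha w hw
    simp only [h_def, sub_self, mul_zero, Real.exp_zero, mul_one] at hτw
    linarith
  have hφder : ∀ x : E, HasDerivAt (fun r => ⟪U r x, x⟫ + h r)
      (⟪(X τ * U τ + U τ * X τ + D τ) x, x⟫ + (2 * C + 1) * h τ) τ :=
    fun x => ((hU τ hτ).inner_clm_apply_self x).add (hder τ)
  have hIco : ∀ᶠ r in nhdsWithin τ (Set.Iio τ), r ∈ Set.Ico a τ := Ico_mem_nhdsLT haτ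
  have hτnonneg : ∀ x : E, ‖x‖ = 1 → 0 ≤ ⟪U τ x, x⟫ + h τ := fun x hx =>
    ge_of_tendsto ((hφder x).continuousAt.tendsto.mono_left nhdsWithin_le_nhds)
      (hIco.mono fun r hr => (hbefore r hr x hx).le)
  have hzero : ⟪U τ w, w⟫ + h τ = 0 := le_antisymm hτw (hτnonneg w hw)
  have hsymm := ContinuousLinearMap.isSelfAdjoint_iff_isSymmetric.mp (hUsa τ hτ)
  have hXsymm := ContinuousLinearMap.isSelfAdjoint_iff_isSymmetric.mp (hXsa τ hτ)
  have hnull : (U τ + h τ • ContinuousLinearMap.id ℝ E) w = 0 := by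
    refine apply_eq_zero_of_inner_apply_self_eq_zero (fun x y => ?_) (fun x => ?_) ?_
    · have := hsymm x y
      simp only [ContinuousLinearMap.coe_coe] at this
      simp [inner_add_left, inner_add_right, inner_smul_left, inner_smul_right, this]
    · rcases eq_or_ne x 0 with rfl | hx
      · simp
      · have hx' : ‖x‖ ≠ 0 := norm_ne_zero_iff.mpr hx
        have h1 := hτnonneg (‖x‖⁻¹ • x) (by simp [norm_smul, hx'])
        simp only [map_smul, inner_smul_left, inner_smul_right, conj_trivial] at h1
        simp only [add_apply, smul_apply, ContinuousLinearMap.id_apply,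
          inner_add_left, inner_smul_left, conj_trivial, real_inner_self_eq_norm_sq]
        have h2 : ⟪U τ x, x⟫ + h τ * ‖x‖ ^ 2
            = ‖x‖ ^ 2 * (‖x‖⁻¹ * (‖x‖⁻¹ * ⟪U τ x, x⟫) + h τ) := by
          field_simp
        rw [h2]
        positivity
    · simpa [inner_add_left, inner_smul_left, hw] using hzero
  have hUw : U τ w = -(h τ • w) := by
    rw [eq_neg_iff_add_eq_zero]
    simpa using hnull
  have hpos' : 0 < ⟪(X τ * U τ + U τ * X τ + D τ) w, w⟫ + (2 * C + 1) * h τ := by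
    have e1 : ⟪U τ (X τ w), w⟫ = -(h τ * ⟪X τ w, w⟫) := by
      have := hsymm (X τ w) w
      simp only [ContinuousLinearMap.coe_coe] at this
      rw [this, hUw, inner_neg_right, inner_smul_right]
    have e2 : ⟪X τ (U τ w), w⟫ = -(h τ * ⟪X τ w, w⟫) := by
      rw [hUw, map_neg, map_smul, inner_neg_left, inner_smul_left, conj_trivial]
    simp only [add_apply, mul_apply_eq_comp, inner_add_left,
      e1, e2]
    nlinarith [hX τ hτ w hw, hD τ hτ w, hpos τ]
  have hnonpos : ⟪(X τ * U τ + U τ * X τ + D τ) w, w⟫ + (2 * C + 1) * h τ ≤ 0 := by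
    have hs := (hasDerivAt_iff_tendsto_slope_left_right.mp (hφder w)).1
    refine le_of_tendsto hs (hIco.mono fun r hr => ?_)
    rw [slope_def_field, hzero, sub_zero]
    exact div_nonpos_of_nonneg_of_nonpos (hbefore r hr w hw).le (by linarith [hr.2])
  linarith

/-- Along a self-adjoint solution of the Riccati equation the quadratic form grows at most
linearly. -/
theorem riccati_inner_le {a b M : ℝ} (hab : a ≤ b) {S R : ℝ → E →L[ℝ] E}
    (hSsa : ∀ t ∈ Set.Icc a b, IsSelfAdjoint (S t))
    (hS : ∀ t ∈ Set.Icc a b, HasDerivAt S (-(S t * S t) - R t) t)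
    (hR : ∀ t ∈ Set.Icc a b, ‖R t‖ ≤ M) {v : E} (hv : ‖v‖ = 1) :
    ⟪S b v, v⟫ ≤ ⟪S a v, v⟫ + M * (b - a) := by
  have hd : ∀ t ∈ Set.Icc a b, HasDerivAt (fun t => ⟪S t v, v⟫ - M * t)
      (⟪(-(S t * S t) - R t) v, v⟫ - M) t := fun t ht =>
    (((hS t ht).inner_clm_apply_self v).sub ((hasDerivAt_id t).const_mul M)).congr_deriv (by simp)
  have hanti : AntitoneOn (fun t => ⟪S t v, v⟫ - M * t) (Set.Icc a b) := by
    refine antitoneOn_of_hasDerivWithinAt_nonpos (convex_Icc a b)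
      (fun t ht => (hd t ht).continuousAt.continuousWithinAt)
      (fun t ht => (hd t (interior_subset ht)).hasDerivWithinAt) fun t ht => ?_
    replace ht := interior_subset ht
    have hsymm := ContinuousLinearMap.isSelfAdjoint_iff_isSymmetric.mp (hSsa t ht) (S t v) v
    simp only [ContinuousLinearMap.coe_coe] at hsymm
    have h2 : -⟪R t v, v⟫ ≤ M := by
      have h3 := (neg_le_abs _).trans (abs_real_inner_le_norm (R t v) v)
      have h4 := (R t).le_opNorm v
      rw [hv, mul_one] at h3 h4
      exact h3.trans (h4.trans (hR t ht))
    have h5 : 0 ≤ ⟪S t v, S t v⟫ := real_inner_self_nonneg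
    simp only [sub_apply, neg_apply,
      mul_apply_eq_comp, inner_sub_left, inner_neg_left, hsymm]
    linarith
  have := hanti (Set.left_mem_Icc.mpr hab) (Set.right_mem_Icc.mpr hab) hab
  simp only at this
  linarith

/-- The difference of two Riccati solutions with ordered coefficients stays nonnegative if its limit
at the left endpoint is nonnegative. -/
theorem riccati_comparison_nonneg {T : ℝ} {R₁ R₂ S₁ S₂ : ℝ → E →L[ℝ] E}
    (hR₁ : Continuous R₁) (hR₂ : Continuous R₂)
    (hR₁₂ : ∀ t : ℝ, ∀ v : E, 0 ≤ ⟪(R₁ t - R₂ t) v, v⟫)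
    (hS₁sa : ∀ t ∈ Set.Ioo (0 : ℝ) T, IsSelfAdjoint (S₁ t))
    (hS₂sa : ∀ t ∈ Set.Ioo (0 : ℝ) T, IsSelfAdjoint (S₂ t))
    (hS₁ : ∀ t ∈ Set.Ioo (0 : ℝ) T, HasDerivAt S₁ (-(S₁ t * S₁ t) - R₁ t) t)
    (hS₂ : ∀ t ∈ Set.Ioo (0 : ℝ) T, HasDerivAt S₂ (-(S₂ t * S₂ t) - R₂ t) t)
    {U₀ : E →L[ℝ] E}
    (hU : Filter.Tendsto (fun t => S₂ t - S₁ t) (nhdsWithin 0 (Set.Ioo 0 T)) (nhds U₀))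
    (hU₀ : ∀ v : E, 0 ≤ ⟪U₀ v, v⟫) {t : ℝ} (ht : t ∈ Set.Ioo 0 T) {v : E} (hv : ‖v‖ = 1) :
    0 ≤ ⟪(S₂ t - S₁ t) v, v⟫ := by
  obtain ⟨M₁, hM₁⟩ :=
    isCompact_Icc.exists_bound_of_continuousOn (hR₁.continuousOn (s := Set.Icc 0 t))
  obtain ⟨M₂, hM₂⟩ :=
    isCompact_Icc.exists_bound_of_continuousOn (hR₂.continuousOn (s := Set.Icc 0 t))
  have h0t : (0 : ℝ) ∈ Set.Icc 0 t := ⟨le_rfl, ht.1.le⟩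
  have hM₁0 : 0 ≤ M₁ := (norm_nonneg _).trans (hM₁ 0 h0t)
  have hM₂0 : 0 ≤ M₂ := (norm_nonneg _).trans (hM₂ 0 h0t)
  set C : ℝ := (‖S₁ t‖ + ‖S₂ t‖ + (M₁ + M₂) * t) / 2
  have hC : 0 ≤ C := by have := ht.1.le; positivity
  have hX : ∀ r ∈ Set.Ioc 0 t, ∀ w : E, ‖w‖ = 1 →
      ⟪(-(1 / 2 : ℝ) • (S₁ r + S₂ r)) w, w⟫ ≤ C := by
    intro r hr w hw
    have hsub : ∀ x ∈ Set.Icc r t, x ∈ Set.Ioo 0 T :=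
      fun x hx => ⟨hr.1.trans_le hx.1, hx.2.trans_lt ht.2⟩
    have hsub' : ∀ x ∈ Set.Icc r t, x ∈ Set.Icc 0 t := fun x hx => ⟨(hsub x hx).1.le, hx.2⟩
    have h1 := riccati_inner_le hr.2 (fun x hx => hS₁sa x (hsub x hx))
      (fun x hx => hS₁ x (hsub x hx)) (fun x hx => hM₁ x (hsub' x hx)) hw
    have h2 := riccati_inner_le hr.2 (fun x hx => hS₂sa x (hsub x hx))
      (fun x hx => hS₂ x (hsub x hx)) (fun x hx => hM₂ x (hsub' x hx)) hw
    have h3 := (abs_le.mp (abs_inner_apply_self_le_norm (S₁ t) hw)).1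
    have h4 := (abs_le.mp (abs_inner_apply_self_le_norm (S₂ t) hw)).1
    have h5 := mul_nonneg hM₁0 hr.1.le
    have h6 := mul_nonneg hM₂0 hr.1.le
    simp only [add_apply, smul_apply, inner_add_left, inner_smul_left, conj_trivial]
    simp only [C]
    linarith
  by_contra! hneg
  set q := ⟪(S₂ t - S₁ t) v, v⟫
  set K : ℝ := 2 * C + 1
  set δ : ℝ := -q * Real.exp (-(K * t))
  have hδ : 0 < δ := mul_pos (neg_pos.mpr hneg) (Real.exp_pos _)
  have : (nhdsWithin (0 : ℝ) (Set.Ioo 0 T)).NeBot := by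
    rw [nhdsWithin_Ioo_eq_nhdsGT (ht.1.trans ht.2)]
    infer_instance
  have hev : ∀ᶠ r in nhdsWithin (0 : ℝ) (Set.Ioo 0 T), r < t :=
    nhdsWithin_le_nhds (Iio_mem_nhds ht.1)
  obtain ⟨r, ⟨hrδ, hrt⟩, hrT⟩ :=
    (((hU.eventually (Metric.ball_mem_nhds U₀ hδ)).and hev).and self_mem_nhdsWithin).exists
  have hsub : ∀ x ∈ Set.Icc r t, x ∈ Set.Ioo 0 T :=
    fun x hx => ⟨hrT.1.trans_le hx.1, hx.2.trans_lt ht.2⟩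
  have hinit : ∀ w : E, ‖w‖ = 1 → -δ < ⟪(S₂ r - S₁ r) w, w⟫ := by
    intro w hw
    have h1 := (abs_le.mp (abs_inner_apply_self_le_norm (S₂ r - S₁ r - U₀) hw)).1
    rw [sub_apply (S₂ r - S₁ r), inner_sub_left] at h1
    have h2 : ‖S₂ r - S₁ r - U₀‖ < δ := by rwa [dist_eq_norm] at hrδ
    linarith [hU₀ w]
  have key := lyapunov_lower_bound (C := C) (b := t) hδ
    (fun x hx => ((hS₂ x (hsub x hx)).sub (hS₁ x (hsub x hx))).congr_deriv
      (riccati_sub_deriv_eq (S₁ x) (S₂ x) (R₁ x) (R₂ x)))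
    (fun x hx => (hS₂sa x (hsub x hx)).sub (hS₁sa x (hsub x hx)))
    (fun x hx => hX x ⟨(hsub x hx).1, hx.2⟩)
    (fun x hx => (IsSelfAdjoint.all (-(1 / 2 : ℝ))).smul
      ((hS₁sa x (hsub x hx)).add (hS₂sa x (hsub x hx))))
    (fun x _ => hR₁₂ x) hinit (t := t) ⟨hrt.le, le_rfl⟩ hv
  have hexp : δ * Real.exp (K * (t - r)) ≤ -q := by
    rw [show -q = δ * Real.exp (K * t) by
      rw [mul_assoc, ← Real.exp_add]; simp]
    have : K * (t - r) ≤ K * t := by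
      have : 0 ≤ K := by positivity
      nlinarith [hrT.1]
    gcongr
  change -(δ * Real.exp (K * (t - r))) < q at key
  linarith

/-- If two Riccati solutions with ordered coefficients agree at `s`, their difference is nonpositive
before `s`. -/
theorem riccati_comparison_nonpos {T s : ℝ} {R₁ R₂ S₁ S₂ : ℝ → E →L[ℝ] E}
    (hR₁₂ : ∀ t : ℝ, ∀ v : E, 0 ≤ ⟪(R₁ t - R₂ t) v, v⟫)
    (hS₁sa : ∀ t ∈ Set.Ioo (0 : ℝ) T, IsSelfAdjoint (S₁ t))
    (hS₂sa : ∀ t ∈ Set.Ioo (0 : ℝ) T, IsSelfAdjoint (S₂ t))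
    (hS₁ : ∀ t ∈ Set.Ioo (0 : ℝ) T, HasDerivAt S₁ (-(S₁ t * S₁ t) - R₁ t) t)
    (hS₂ : ∀ t ∈ Set.Ioo (0 : ℝ) T, HasDerivAt S₂ (-(S₂ t * S₂ t) - R₂ t) t)
    (hsT : s < T) (heq : S₁ s = S₂ s) {t : ℝ} (ht : t ∈ Set.Ioc 0 s) {v : E} (hv : ‖v‖ = 1) :
    ⟪(S₂ t - S₁ t) v, v⟫ ≤ 0 := by
  have hsub : ∀ x ∈ Set.Icc t s, x ∈ Set.Ioo 0 T :=
    fun x hx => ⟨ht.1.trans_le hx.1, hx.2.trans_lt hsT⟩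
  have hrefl : ∀ x ∈ Set.Icc 0 (s - t), s - x ∈ Set.Icc t s :=
    fun x hx => ⟨by linarith [hx.2], by linarith [hx.1]⟩
  have hcont : ContinuousOn (fun x => (1 / 2 : ℝ) • (S₁ x + S₂ x)) (Set.Icc t s) := fun x hx =>
    (((hS₁ x (hsub x hx)).continuousAt.add (hS₂ x (hsub x hx)).continuousAt).const_smul
      (1 / 2 : ℝ)).continuousWithinAt
  obtain ⟨C, hC⟩ := isCompact_Icc.exists_bound_of_continuousOn hcont
  have hbound : ∀ δ > 0, -(δ * Real.exp ((2 * C + 1) * (s - t - 0))) <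
      ⟪(S₁ (s - (s - t)) - S₂ (s - (s - t))) v, v⟫ := by
    intro δ hδ
    refine lyapunov_lower_bound (a := 0) (b := s - t) (C := C) hδ
      (U := fun x => S₁ (s - x) - S₂ (s - x))
      (X := fun x => (1 / 2 : ℝ) • (S₁ (s - x) + S₂ (s - x)))
      (D := fun x => R₁ (s - x) - R₂ (s - x))
      (fun x hx => ?_) (fun x hx => ?_) (fun x hx w hw => ?_) (fun x hx => ?_)
      (fun x _ => hR₁₂ _) (fun w _ => ?_) ⟨by linarith [ht.2], le_rfl⟩ hv
    · have hx' := hsub _ (hrefl x hx)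
      have h1 := ((hS₁ _ hx').sub (hS₂ _ hx')).comp_const_sub s x
      refine h1.congr_deriv ?_
      simp only [smul_mul_assoc, mul_smul_comm, mul_add, add_mul, mul_sub, sub_mul]
      module
    · have hx' := hsub _ (hrefl x hx)
      exact (hS₁sa _ hx').sub (hS₂sa _ hx')
    · exact (le_abs_self _).trans ((abs_inner_apply_self_le_norm _ hw).trans (hC _ (hrefl x hx)))
    · have hx' := hsub _ (hrefl x hx)
      exact (IsSelfAdjoint.all (1 / 2 : ℝ)).smul ((hS₁sa _ hx').add (hS₂sa _ hx'))
    · simpa [heq] using hδ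
  rw [sub_sub_cancel] at hbound
  by_contra! hpos
  have h1 := hbound (⟪(S₂ t - S₁ t) v, v⟫ * Real.exp (-((2 * C + 1) * (s - t - 0))))
    (mul_pos hpos (Real.exp_pos _))
  rw [mul_assoc, ← Real.exp_add, neg_add_cancel, Real.exp_zero, mul_one, ← inner_neg_left,
    ← neg_apply, neg_sub] at h1
  exact lt_irrefl _ h1

/-- Local existence of self-adjoint solutions of the Riccati equation. -/
theorem exists_selfAdjoint_riccati_solution {R : ℝ → E →L[ℝ] E} (hR : ContDiff ℝ 1 R)
    (hRsa : ∀ t, IsSelfAdjoint (R t)) (t₀ : ℝ) {L : E →L[ℝ] E} (hL : IsSelfAdjoint L) :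
    ∃ ε > 0, ∃ Y : ℝ → E →L[ℝ] E, Y t₀ = L ∧ ∀ t ∈ Set.Ioo (t₀ - ε) (t₀ + ε),
      IsSelfAdjoint (Y t) ∧ HasDerivAt Y (-(Y t * Y t) - R t) t := by
  -- Symmetrising the quadratic term keeps the solution self-adjoint.
  let P : (E →L[ℝ] E) →L[ℝ] (E →L[ℝ] E) :=
    (1 / 2 : ℝ) • (ContinuousLinearMap.id ℝ _ + ((starL' ℝ : (E →L[ℝ] E) ≃L[ℝ] (E →L[ℝ] E)) :
      (E →L[ℝ] E) →L[ℝ] (E →L[ℝ] E)))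
  have hP : ∀ Y, P Y = (1 / 2 : ℝ) • (Y + star Y) := fun Y => by simp [P]
  have hPsa : ∀ Y, IsSelfAdjoint (P Y) := fun Y => by
    rw [hP]
    exact (IsSelfAdjoint.all (1 / 2 : ℝ)).smul (IsSelfAdjoint.add_star_self Y)
  let f : ℝ × (E →L[ℝ] E) → ℝ × (E →L[ℝ] E) := fun p => (1, -(P p.2 * P p.2) - R p.1)
  have hf : ContDiff ℝ 1 f := by
    have h1 : ContDiff ℝ 1 fun p : ℝ × (E →L[ℝ] E) => P p.2 := P.contDiff.comp contDiff_snd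
    exact contDiff_const.prodMk ((h1.clm_comp h1).neg.sub (hR.comp contDiff_fst))
  obtain ⟨α, hα₀, ε, hε, hα⟩ :=
    (hf.contDiffAt (x := (t₀, L))).exists_forall_mem_closedBall_exists_eq_forall_mem_Ioo_hasDerivAt₀
      t₀
  have ht₀ : t₀ ∈ Set.Ioo (t₀ - ε) (t₀ + ε) := ⟨by linarith, by linarith⟩
  have hfst : ∀ t ∈ Set.Ioo (t₀ - ε) (t₀ + ε), (α t).1 = t := by
    intro t ht
    have hd : ∀ r ∈ Set.Ioo (t₀ - ε) (t₀ + ε), HasDerivAt (fun r => (α r).1 - r) 0 r :=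
      fun r hr => (((ContinuousLinearMap.fst ℝ ℝ (E →L[ℝ] E)).hasFDerivAt.comp_hasDerivAt r
        (hα r hr)).sub (hasDerivAt_id r)).congr_deriv (by simp [f])
    have := (isOpen_Ioo (a := t₀ - ε) (b := t₀ + ε)).is_const_of_deriv_eq_zero isPreconnected_Ioo
      (fun r hr => (hd r hr).differentiableAt.differentiableWithinAt)
      (fun r hr => (hd r hr).deriv) ht ht₀
    simp only [hα₀, sub_self] at this
    linarith
  have hsnd : ∀ t ∈ Set.Ioo (t₀ - ε) (t₀ + ε),
      HasDerivAt (fun t => (α t).2) (-(P (α t).2 * P (α t).2) - R t) t := by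
    intro t ht
    exact ((ContinuousLinearMap.snd ℝ ℝ (E →L[ℝ] E)).hasFDerivAt.comp_hasDerivAt t
      (hα t ht)).congr_deriv (by simp [f, hfst t ht])
  have hsa : ∀ t ∈ Set.Ioo (t₀ - ε) (t₀ + ε), IsSelfAdjoint (α t).2 := by
    intro t ht
    have hd : ∀ r ∈ Set.Ioo (t₀ - ε) (t₀ + ε),
        HasDerivAt (fun r => star (α r).2 - (α r).2) 0 r := fun r hr => by
      have hrhs : IsSelfAdjoint (-(P (α r).2 * P (α r).2) - R r) := by
        refine IsSelfAdjoint.sub (IsSelfAdjoint.neg ?_) (hRsa r)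
        exact ((hPsa _).commute_iff (hPsa _)).mp (Commute.refl _)
      exact ((hsnd r hr).star.sub (hsnd r hr)).congr_deriv (by rw [hrhs.star_eq, sub_self])
    have := (isOpen_Ioo (a := t₀ - ε) (b := t₀ + ε)).is_const_of_deriv_eq_zero isPreconnected_Ioo
      (fun r hr => (hd r hr).differentiableAt.differentiableWithinAt)
      (fun r hr => (hd r hr).deriv) ht ht₀
    simp only [hα₀, hL.star_eq, sub_self] at this
    exact sub_eq_zero.mp this
  refine ⟨ε, hε, fun t => (α t).2, by simp [hα₀], fun t ht => ⟨hsa t ht, ?_⟩⟩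
  have h1 : P (α t).2 = (α t).2 := by
    rw [hP, (hsa t ht).star_eq, ← two_smul ℝ, smul_smul]
    norm_num
  have h2 := hsnd t ht
  rwa [h1] at h2

/-- A self-adjoint Riccati solution which stays bounded near the right endpoint of its interval
extends beyond that endpoint. -/
theorem riccati_extends_of_bounded {R S : ℝ → E →L[ℝ] E} (hR : ContDiff ℝ 1 R)
    (hRsa : ∀ t, IsSelfAdjoint (R t)) {T c B : ℝ} (hc : c ∈ Set.Ioo 0 T)
    (hSsa : ∀ t ∈ Set.Ioo (0 : ℝ) T, IsSelfAdjoint (S t))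
    (hS : ∀ t ∈ Set.Ioo (0 : ℝ) T, HasDerivAt S (-(S t * S t) - R t) t)
    (hB : ∀ t ∈ Set.Ioo c T, ‖S t‖ ≤ B) :
    ∃ T' > T, ∃ S' : ℝ → E →L[ℝ] E,
      (∀ t ∈ Set.Ioo (0 : ℝ) T', IsSelfAdjoint (S' t)) ∧
      (∀ t ∈ Set.Ioo (0 : ℝ) T', HasDerivAt S' (-(S' t * S' t) - R t) t) ∧
      (∀ t ∈ Set.Ioo (0 : ℝ) T, S' t = S t) := by
  obtain ⟨M, hM⟩ :=
    isCompact_Icc.exists_bound_of_continuousOn (hR.continuous.continuousOn (s := Set.Icc c T))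
  have hsub : ∀ t ∈ Set.Ioo c T, t ∈ Set.Ioo 0 T := fun t ht => ⟨hc.1.trans ht.1, ht.2⟩
  have hderiv : ∀ t ∈ Set.Ioo c T, ‖-(S t * S t) - R t‖₊ ≤ (B * B + M).toNNReal := by
    intro t ht
    rw [← NNReal.coe_le_coe, coe_nnnorm]
    refine le_trans ?_ (Real.le_coe_toNNReal _)
    refine (norm_sub_le _ _).trans (add_le_add ?_ (hM t (Set.Ioo_subset_Icc_self ht)))
    rw [norm_neg]
    exact (norm_mul_le _ _).trans (mul_self_le_mul_self (norm_nonneg _) (hB t ht))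
  have hlip := (convex_Ioo c T).lipschitzOnWith_of_nnnorm_hasDerivWithin_le
    (fun t ht => (hS t (hsub t ht)).hasDerivWithinAt) hderiv
  obtain ⟨g, hg, hgS⟩ := hlip.extend_finite_dimension
  have hIoo : Set.Ioo c T ∈ nhdsWithin T (Set.Iio T) := Ioo_mem_nhdsLT hc.2
  have hlim : Filter.Tendsto S (nhdsWithin T (Set.Iio T)) (nhds (g T)) :=
    (hg.continuous.continuousAt.tendsto.mono_left nhdsWithin_le_nhds).congr'
      (Filter.mem_of_superset hIoo fun t ht => (hgS ht).symm)
  have hLsa : IsSelfAdjoint (g T) :=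
    (isClosed_eq continuous_star continuous_id).mem_of_tendsto hlim
      (Filter.mem_of_superset hIoo fun t ht => hSsa t (hsub t ht))
  obtain ⟨ε, hε, Y, hYT, hY⟩ := exists_selfAdjoint_riccati_solution hR hRsa T hLsa
  have hT : T ∈ Set.Ioo (T - ε) (T + ε) := ⟨by linarith, by linarith⟩
  let S' : ℝ → E →L[ℝ] E := fun t => if t < T then S t else Y t
  have hlt : ∀ t < T, S' t = S t := fun t ht => if_pos ht
  have hge : ∀ t, T ≤ t → S' t = Y t := fun t ht => if_neg ht.not_gt
  have hltev : ∀ t < T, S' =ᶠ[nhds t] S := fun t ht =>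
    Filter.mem_of_superset (Iio_mem_nhds ht) hlt
  refine ⟨T + ε, by linarith, S', fun t ht => ?_, fun t ht => ?_, fun t ht => hlt t ht.2⟩
  · rcases lt_or_ge t T with h | h
    · rw [hlt t h]; exact hSsa t ⟨ht.1, h⟩
    · rw [hge t h]; exact (hY t ⟨by linarith, ht.2⟩).1
  · rcases lt_trichotomy t T with h | h | h
    · rw [hlt t h]
      exact (hS t ⟨ht.1, h⟩).congr_of_eventuallyEq (hltev t h)
    · subst h
      rw [hge t le_rfl]
      have hright : HasDerivWithinAt S' (-(Y t * Y t) - R t) (Set.Ici t) t :=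
        (hY t hT).2.hasDerivWithinAt.congr (fun x hx => hge x hx) (hge t le_rfl)
      have hlim' : Filter.Tendsto S' (nhdsWithin t (Set.Iio t)) (nhds (Y t)) := by
        rw [hYT]
        exact hlim.congr' (Filter.mem_of_superset self_mem_nhdsWithin fun x hx => (hlt x hx).symm)
      have hleft : HasDerivWithinAt S' (-(Y t * Y t) - R t) (Set.Iic t) t := by
        have hd : ∀ x ∈ Set.Ioo c t, HasDerivAt S' (-(S' x * S' x) - R x) x := fun x hx => by
          rw [hlt x hx.2]
          exact (hS x (hsub x hx)).congr_of_eventuallyEq (hltev x hx.2)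
        refine hasDerivWithinAt_Iic_of_tendsto_deriv (s := Set.Ioo c t)
          (fun x hx => (hd x hx).differentiableAt.differentiableWithinAt) ?_ hIoo ?_
        · rw [ContinuousWithinAt, hge t le_rfl]
          exact hlim'.mono_left (nhdsWithin_mono _ fun x hx => hx.2)
        · have h1 : Filter.Tendsto (fun x => -(S' x * S' x) - R x) (nhdsWithin t (Set.Iio t))
              (nhds (-(Y t * Y t) - R t)) :=
            (hlim'.mul hlim').neg.sub
              (hR.continuous.continuousAt.tendsto.mono_left nhdsWithin_le_nhds)
          exact h1.congr' (Filter.mem_of_superset hIoo fun x hx => (hd x hx).deriv.symm)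
      have := hleft.union hright
      rwa [Set.Iic_union_Ici, hasDerivWithinAt_univ] at this
    · rw [hge t h.le]
      exact (hY t ⟨by linarith, ht.2⟩).2.congr_of_eventuallyEq
        (Filter.mem_of_superset (Ioi_mem_nhds h) fun x hx => hge x (le_of_lt hx))

end

/-- **Riccati comparison (Eschenburg–Heintze), part 3.**
`E` is a finite-dimensional real inner product space; endomorphisms are modelled as
continuous linear maps `E →L[ℝ] E` (all linear maps are continuous in finite dimension).
`R₁, R₂ : ℝ → S(E)` are smooth with `R₁ ≥ R₂`; for `i = 1, 2`, `Sᵢ` is a self-adjoint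
solution of `Sᵢ' + Sᵢ² + Rᵢ = 0` on `(0, tᵢ)` which cannot be extended beyond `tᵢ`;
`U = S₂ - S₁` extends continuously to `t = 0` with `U(0) ≥ 0`.
If moreover `S₁(s) = S₂(s)` for some `s ∈ (0, t₁)`, then `S₁ = S₂` and `R₁ = R₂` on `(0, s]`. -/
theorem riccati_comparison_rigidity
    {E : Type*} [NormedAddCommGroup E] [InnerProductSpace ℝ E] [FiniteDimensional ℝ E]
    (t₁ t₂ : ℝ) (ht₁ : 0 < t₁) (ht₂ : 0 < t₂)
    (R₁ R₂ : ℝ → E →L[ℝ] E)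
    (hR₁smooth : ContDiff ℝ (⊤ : ℕ∞) R₁) (hR₂smooth : ContDiff ℝ (⊤ : ℕ∞) R₂)
    (hR₁sa : ∀ t : ℝ, IsSelfAdjoint (R₁ t)) (hR₂sa : ∀ t : ℝ, IsSelfAdjoint (R₂ t))
    (hR₁₂ : ∀ t : ℝ, ∀ v : E, 0 ≤ ⟪(R₁ t - R₂ t) v, v⟫)
    (S₁ S₂ : ℝ → E →L[ℝ] E)
    (hS₁sa : ∀ t ∈ Set.Ioo (0 : ℝ) t₁, IsSelfAdjoint (S₁ t))
    (hS₂sa : ∀ t ∈ Set.Ioo (0 : ℝ) t₂, IsSelfAdjoint (S₂ t))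
    (hS₁ : ∀ t ∈ Set.Ioo (0 : ℝ) t₁, HasDerivAt S₁ (-(S₁ t * S₁ t) - R₁ t) t)
    (hS₂ : ∀ t ∈ Set.Ioo (0 : ℝ) t₂, HasDerivAt S₂ (-(S₂ t * S₂ t) - R₂ t) t)
    (hmax₁ : ∀ t' > t₁, ¬ ∃ S : ℝ → E →L[ℝ] E,
      (∀ t ∈ Set.Ioo (0 : ℝ) t', IsSelfAdjoint (S t)) ∧
      (∀ t ∈ Set.Ioo (0 : ℝ) t', HasDerivAt S (-(S t * S t) - R₁ t) t) ∧
      (∀ t ∈ Set.Ioo (0 : ℝ) t₁, S t = S₁ t))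
    (hmax₂ : ∀ t' > t₂, ¬ ∃ S : ℝ → E →L[ℝ] E,
      (∀ t ∈ Set.Ioo (0 : ℝ) t', IsSelfAdjoint (S t)) ∧
      (∀ t ∈ Set.Ioo (0 : ℝ) t', HasDerivAt S (-(S t * S t) - R₂ t) t) ∧
      (∀ t ∈ Set.Ioo (0 : ℝ) t₂, S t = S₂ t))
    (U₀ : E →L[ℝ] E)
    (hUcont : Filter.Tendsto (fun t => S₂ t - S₁ t)
      (nhdsWithin 0 (Set.Ioo 0 (min t₁ t₂))) (nhds U₀))
    (hU₀ : ∀ v : E, 0 ≤ ⟪U₀ v, v⟫)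
    (s : ℝ) (hs : s ∈ Set.Ioo (0 : ℝ) t₁) (heq : S₁ s = S₂ s) :
    ∀ t ∈ Set.Ioc (0 : ℝ) s, S₁ t = S₂ t ∧ R₁ t = R₂ t := by
  have hR₁c := hR₁smooth.continuous
  have hR₂c := hR₂smooth.continuous
  have hlt₁ : ∀ {t}, t ∈ Set.Ioo 0 (min t₁ t₂) → t ∈ Set.Ioo 0 t₁ :=
    fun ht => ⟨ht.1, ht.2.trans_le (min_le_left _ _)⟩
  have hlt₂ : ∀ {t}, t ∈ Set.Ioo 0 (min t₁ t₂) → t ∈ Set.Ioo 0 t₂ :=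
    fun ht => ⟨ht.1, ht.2.trans_le (min_le_right _ _)⟩
  have hnonneg : ∀ t ∈ Set.Ioo 0 (min t₁ t₂), ∀ v : E, ‖v‖ = 1 → 0 ≤ ⟪(S₂ t - S₁ t) v, v⟫ :=
    fun t ht v hv => riccati_comparison_nonneg hR₁c hR₂c hR₁₂
      (fun r hr => hS₁sa r (hlt₁ hr)) (fun r hr => hS₂sa r (hlt₂ hr))
      (fun r hr => hS₁ r (hlt₁ hr)) (fun r hr => hS₂ r (hlt₂ hr)) hUcont hU₀ ht hv
  have hst₂ : s < t₂ := by
    by_contra! hts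
    have ht₂₁ : t₂ < t₁ := hts.trans_lt hs.2
    have hc : t₂ / 2 ∈ Set.Ioo 0 t₂ := ⟨by linarith, by linarith⟩
    obtain ⟨B, hB⟩ := isCompact_Icc.exists_bound_of_continuousOn
      (s := Set.Icc (t₂ / 2) t₂) (f := S₁) fun t ht =>
        (hS₁ t ⟨hc.1.trans_le ht.1, ht.2.trans_lt ht₂₁⟩).continuousAt.continuousWithinAt
    obtain ⟨M, hM⟩ := isCompact_Icc.exists_bound_of_continuousOn
      (hR₂c.continuousOn (s := Set.Icc (t₂ / 2) t₂))
    have hcc : t₂ / 2 ∈ Set.Icc (t₂ / 2) t₂ := ⟨le_rfl, hc.2.le⟩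
    have hB0 : 0 ≤ B := (norm_nonneg _).trans (hB _ hcc)
    have hM0 : 0 ≤ M := (norm_nonneg _).trans (hM _ hcc)
    have hbound : ∀ t ∈ Set.Ioo (t₂ / 2) t₂, ‖S₂ t‖ ≤ B + ‖S₂ (t₂ / 2)‖ + M * t₂ := by
      intro t ht
      have htI : t ∈ Set.Ioo 0 t₂ := ⟨hc.1.trans ht.1, ht.2⟩
      have hMt : 0 ≤ M * t₂ := mul_nonneg hM0 ht₂.le
      refine (hS₂sa t htI).norm_le_of_abs_inner_le (fun v hv => ?_) (by positivity)
      have hup := riccati_inner_le ht.1.le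
        (fun r hr => hS₂sa r ⟨hc.1.trans_le hr.1, hr.2.trans_lt ht.2⟩)
        (fun r hr => hS₂ r ⟨hc.1.trans_le hr.1, hr.2.trans_lt ht.2⟩)
        (fun r hr => hM r ⟨hr.1, hr.2.trans ht.2.le⟩) hv
      have hlow := hnonneg t ⟨htI.1, lt_min (ht.2.trans ht₂₁) ht.2⟩ v hv
      rw [sub_apply, inner_sub_left] at hlow
      have h1 := (abs_le.mp (abs_inner_apply_self_le_norm (S₁ t) hv)).1
      have h2 := (abs_le.mp (abs_inner_apply_self_le_norm (S₂ (t₂ / 2)) hv)).2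
      have h3 := hB t (Set.Ioo_subset_Icc_self ht)
      have h4 : M * (t - t₂ / 2) ≤ M * t₂ :=
        mul_le_mul_of_nonneg_left (by linarith [ht.2]) hM0
      have h5 := norm_nonneg (S₂ (t₂ / 2))
      exact abs_le.mpr ⟨by linarith, by linarith⟩
    obtain ⟨T', hT', hex⟩ := riccati_extends_of_bounded (hR₂smooth.of_le (by norm_cast))
      hR₂sa hc hS₂sa hS₂ hbound
    exact hmax₂ T' hT' hex
  have hsmin : s < min t₁ t₂ := lt_min hs.2 hst₂
  have hmem : ∀ t ∈ Set.Ioc 0 s, t ∈ Set.Ioo 0 (min t₁ t₂) :=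
    fun t ht => ⟨ht.1, ht.2.trans_lt hsmin⟩
  have hSeq : ∀ t ∈ Set.Ioc 0 s, S₁ t = S₂ t := by
    intro t ht
    have htm := hmem t ht
    have hsa := (hS₂sa t (hlt₂ htm)).sub (hS₁sa t (hlt₁ htm))
    have h0 := hsa.norm_le_of_abs_inner_le (C := 0) (fun v hv => ?_) le_rfl
    · exact (sub_eq_zero.mp (norm_le_zero_iff.mp h0)).symm
    · rw [abs_nonpos_iff]
      refine le_antisymm (riccati_comparison_nonpos hR₁₂
        (fun r hr => hS₁sa r (hlt₁ hr)) (fun r hr => hS₂sa r (hlt₂ hr))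
        (fun r hr => hS₁ r (hlt₁ hr)) (fun r hr => hS₂ r (hlt₂ hr)) hsmin heq ht hv)
        (hnonneg t htm v hv)
  intro t ht
  refine ⟨hSeq t ht, ?_⟩
  have htm := hmem t ht
  have h1 : HasDerivWithinAt S₁ (-(S₂ t * S₂ t) - R₂ t) (Set.Ioc 0 t) t :=
    (hS₂ t (hlt₂ htm)).hasDerivWithinAt.congr
      (fun r hr => hSeq r ⟨hr.1, hr.2.trans ht.2⟩) (hSeq t ht)
  have huniq : UniqueDiffWithinAt ℝ (Set.Ioc 0 t) t :=
    uniqueDiffOn_Ioc 0 t t ⟨ht.1, le_rfl⟩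
  have h2 := huniq.eq_deriv _ (hS₁ t (hlt₁ htm)).hasDerivWithinAt h1
  rw [hSeq t ht] at h2
  exact sub_right_injective h2
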